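/- Let S be an m×m symmetric positive definite real matrix with non-positive off-diagonal entries and entrywise nonnegative inverse, D a nonnegative diagonal matrix, M a diagonal matrix with positive diagonal entries. Suppose additionally that S + D is irreducible in the sense that some power of (S+D)⁻¹ is entrywise positive. Then the generalized eigenvalue problem (S + D) u = λ M u has a smallest eigenvalue λ₁ > 0 whose eigenspace is one-dimensional, and the corresponding eigenvector can be chosen entrywise positive. -/

import Mathlib

open Matrix

namespace Matrix

variable {n : Type*} [Fintype n]

/-- The quotient of two quadratic forms attains its minimum when the denominator is positive
definite. -/
theorem PosDef.exists_posSemidef_sub_smul [Nonempty n] {A M : Matrix n n ℝ}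
    (hA : A.IsHermitian) (hM : M.PosDef) :
    ∃ (l : ℝ) (x : n → ℝ), x ≠ 0 ∧ (A - l • M).PosSemidef ∧ (A - l • M) *ᵥ x = 0 := by
  have hMpos : ∀ x : n → ℝ, x ≠ 0 → 0 < x ⬝ᵥ M *ᵥ x := fun x hx => by
    simpa using hM.dotProduct_mulVec_pos hx
  have hquad (B : Matrix n n ℝ) : Continuous fun x : n → ℝ => x ⬝ᵥ B *ᵥ x := by
    fun_prop
  have hne : ∀ x ∈ Metric.sphere (0 : n → ℝ) 1, x ≠ 0 := fun x hx =>
    ne_zero_of_mem_unit_sphere ⟨x, hx⟩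
  obtain ⟨x, hx, hmin⟩ := (isCompact_sphere (0 : n → ℝ) 1).exists_isMinOn
    (NormedSpace.sphere_nonempty.2 zero_le_one)
    (f := fun x => (x ⬝ᵥ A *ᵥ x) / (x ⬝ᵥ M *ᵥ x))
    ((hquad A).continuousOn.div (hquad M).continuousOn fun x hx => (hMpos x (hne x hx)).ne')
  set l := (x ⬝ᵥ A *ᵥ x) / (x ⬝ᵥ M *ᵥ x) with hl
  have hform (y : n → ℝ) : y ⬝ᵥ (A - l • M) *ᵥ y = y ⬝ᵥ A *ᵥ y - l * (y ⬝ᵥ M *ᵥ y) := by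
    simp [sub_mulVec, smul_mulVec, dotProduct_sub]
  have hpsd : (A - l • M).PosSemidef := by
    refine .of_dotProduct_mulVec_nonneg (hA.sub ?_) fun y => ?_
    · rw [IsHermitian, conjTranspose_smul, hM.isHermitian.eq, star_trivial]
    rw [star_trivial, hform]
    by_cases hy : y = 0
    · simp [hy]
    have hy' : ‖y‖⁻¹ ≠ 0 := inv_ne_zero (norm_ne_zero_iff.2 hy)
    have h := isMinOn_iff.1 hmin (‖y‖⁻¹ • y) (by simp [norm_smul, hy])
    simp only [mulVec_smul, dotProduct_smul, smul_dotProduct, smul_eq_mul] at h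
    rw [mul_div_mul_left _ _ hy', mul_div_mul_left _ _ hy', ← hl, le_div_iff₀ (hMpos y hy)] at h
    exact sub_nonneg.2 h
  refine ⟨l, x, hne x hx, hpsd, (hpsd.dotProduct_mulVec_zero_iff x).1 ?_⟩
  rw [star_trivial, hform, hl, div_mul_cancel₀ _ (hMpos x (hne x hx)).ne', sub_self]

/-- The kernel of a positive semidefinite matrix with nonpositive off-diagonal entries is closed
under taking entrywise absolute values. -/
theorem PosSemidef.mulVec_abs_eq_zero {C : Matrix n n ℝ} (hC : C.PosSemidef)
    (hoff : ∀ i j, i ≠ j → C i j ≤ 0) {u : n → ℝ} (hu : C *ᵥ u = 0) : C *ᵥ |u| = 0 := by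
  refine (hC.dotProduct_mulVec_zero_iff _).1 (le_antisymm ?_ (hC.dotProduct_mulVec_nonneg _))
  have h0 : u ⬝ᵥ C *ᵥ u = 0 := by simp [hu]
  rw [star_trivial, ← h0]
  simp only [dotProduct, mulVec, Finset.mul_sum]
  refine Finset.sum_le_sum fun i _ => Finset.sum_le_sum fun j _ => ?_
  simp only [Pi.abs_apply]
  rcases eq_or_ne i j with rfl | hij
  · rw [mul_left_comm, abs_mul_abs_self, mul_left_comm]
  · have h : u i * u j ≤ |u i| * |u j| := (le_abs_self _).trans (abs_mul _ _).le
    nlinarith [hoff i j hij]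

/-- Let `A` have nonpositive off-diagonal entries and some entrywise positive power of its inverse.
Then a nonzero nonnegative vector `w` such that `A *ᵥ w` is an entrywise multiple of `w` has no zero
entry. -/
theorem pos_of_mulVec_eq_mul [DecidableEq n] {A : Matrix n n ℝ} (hA : IsUnit A)
    (hoff : ∀ i j, i ≠ j → A i j ≤ 0) {k : ℕ} (hk : ∀ i j, 0 < (A⁻¹ ^ k) i j)
    {d w : n → ℝ} (hw : 0 ≤ w) (hw0 : w ≠ 0) (h : A *ᵥ w = d * w) (i : n) : 0 < w i := by
  refine (hw i).lt_of_ne' fun hi => ?_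
  have hzero : ∀ a, w a = 0 → ∀ b, w b ≠ 0 → A a b = 0 := by
    intro a ha b hb
    have hsum : ∑ j, A a j * w j = 0 := (congrFun h a).trans (by simp [ha])
    have hle : ∀ j ∈ Finset.univ, A a j * w j ≤ 0 := by
      intro j _
      rcases eq_or_ne a j with rfl | haj
      · simp [ha]
      · exact mul_nonpos_of_nonpos_of_nonneg (hoff a j haj) (hw j)
    exact (mul_eq_zero.1 ((Finset.sum_eq_zero_iff_of_nonpos hle).1 hsum b
      (Finset.mem_univ b))).resolve_right hb
  let V : Submodule ℝ (n → ℝ) :=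
    { carrier := {x | ∀ a, w a = 0 → x a = 0}
      add_mem' := fun hx hy a ha => by simp [hx a ha, hy a ha]
      zero_mem' := fun _ _ => rfl
      smul_mem' := fun c x hx a ha => by simp [hx a ha] }
  have hAV : ∀ x ∈ V, A.mulVecLin x ∈ V := by
    intro x hx a ha
    refine Finset.sum_eq_zero fun b _ => ?_
    by_cases hb : w b = 0
    · simp [hx b hb]
    · simp [hzero a ha b hb]
  have hinj : Function.Injective (A.mulVecLin.restrict hAV) := fun x y hxy =>
    Subtype.ext (mulVec_injective_of_isUnit hA (congrArg Subtype.val hxy))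
  have hinvV : ∀ y ∈ V, A⁻¹ *ᵥ y ∈ V := by
    intro y hy
    obtain ⟨x, hx⟩ := LinearMap.injective_iff_surjective.1 hinj ⟨y, hy⟩
    have hxy : A *ᵥ (x : n → ℝ) = y := congrArg Subtype.val hx
    rw [← hxy, mulVec_mulVec, nonsing_inv_mul _ ((isUnit_iff_isUnit_det A).1 hA), one_mulVec]
    exact x.2
  have hpowV : ∀ p : ℕ, (A⁻¹ ^ p) *ᵥ w ∈ V := by
    intro p
    induction p with
    | zero => rw [pow_zero, one_mulVec]; exact fun _ ha => ha
    | succ p ih => rw [pow_succ', ← mulVec_mulVec]; exact hinvV _ ih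
  obtain ⟨b, hb⟩ := Function.ne_iff.1 hw0
  have hpos : 0 < ((A⁻¹ ^ k) *ᵥ w) i :=
    Finset.sum_pos' (fun j _ => mul_nonneg (hk i j).le (hw j))
      ⟨b, Finset.mem_univ b, mul_pos (hk i b) ((hw b).lt_of_ne' hb)⟩
  exact hpos.ne' (hpowV k i hi)

end Matrix

/-- The smallest generalized eigenvalue of an irreducible M-matrix pencil is positive
and simple, with an entrywise positive eigenvector. -/
theorem smallest_generalized_eigenvalue (m : ℕ) (S : Matrix (Fin m) (Fin m) ℝ)
    (hsym : Sᵀ = S) (hpd : S.PosDef) (hoff : ∀ i j, i ≠ j → S i j ≤ 0)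
    (hSinv : ∀ i j, 0 ≤ S⁻¹ i j)
    (dD : Fin m → ℝ) (hdD : ∀ i, 0 ≤ dD i)
    (dM : Fin m → ℝ) (hdM : ∀ i, 0 < dM i) (hm : 0 < m) :
    letI A : Matrix (Fin m) (Fin m) ℝ := S + Matrix.diagonal dD
    letI M : Matrix (Fin m) (Fin m) ℝ := Matrix.diagonal dM
    ∀ _ : ∃ k : ℕ, ∀ i j, 0 < (A⁻¹ ^ k) i j,
    letI Eig : ℝ → Set (Fin m → ℝ) := fun lam =>
      {u | A.mulVec u = lam • M.mulVec u}
    letI Lam : Set ℝ := {lam | ∃ u, u ≠ 0 ∧ u ∈ Eig lam}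
    (∀ lam ∈ Lam, 0 < lam) ∧
      ∃ lam₁ ∈ Lam, (∀ lam ∈ Lam, lam₁ ≤ lam) ∧
        (∃ u ∈ Eig lam₁, ∀ i, 0 < u i) ∧
        (∀ u ∈ Eig lam₁, ∀ v ∈ Eig lam₁, u ≠ 0 → ∃ c : ℝ, v = c • u) := by
  rintro ⟨k, hk⟩
  set A : Matrix (Fin m) (Fin m) ℝ := S + diagonal dD
  set M : Matrix (Fin m) (Fin m) ℝ := diagonal dM
  let Eig : ℝ → Set (Fin m → ℝ) := fun lam => {u | A *ᵥ u = lam • M *ᵥ u}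
  have : Nonempty (Fin m) := ⟨⟨0, hm⟩⟩
  have hA : A.PosDef := hpd.add_posSemidef (PosSemidef.diagonal hdD)
  have hM : M.PosDef := PosDef.diagonal hdM
  have hMpos : ∀ u : Fin m → ℝ, u ≠ 0 → 0 < u ⬝ᵥ M *ᵥ u := fun u hu => by
    simpa using hM.dotProduct_mulVec_pos hu
  have hAoff : ∀ i j, i ≠ j → A i j ≤ 0 := fun i j hij => by
    simpa [A, hij] using hoff i j hij
  have hrayleigh : ∀ lam, ∀ u ∈ Eig lam, u ⬝ᵥ A *ᵥ u = lam * (u ⬝ᵥ M *ᵥ u) := by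
    intro lam u hu
    rw [show A *ᵥ u = lam • M *ᵥ u from hu, dotProduct_smul, smul_eq_mul]
  obtain ⟨l, x, hx, hpsd, hker⟩ := PosDef.exists_posSemidef_sub_smul hA.isHermitian hM
  have hmem : ∀ u, u ∈ Eig l ↔ (A - l • M) *ᵥ u = 0 := fun u => by
    rw [sub_mulVec, smul_mulVec, sub_eq_zero]
    rfl
  have habs : ∀ u ∈ Eig l, |u| ∈ Eig l := fun u hu => by
    refine (hmem _).2 (hpsd.mulVec_abs_eq_zero (fun i j hij => ?_) ((hmem u).1 hu))
    simpa [M, hij] using hAoff i j hij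
  have hpos : ∀ u ∈ Eig l, u ≠ 0 → ∀ i, 0 < |u| i := fun u hu hu0 =>
    pos_of_mulVec_eq_mul hA.isUnit hAoff hk (d := l • dM) (abs_nonneg u) (by simpa using hu0) <| by
      rw [show A *ᵥ |u| = l • M *ᵥ |u| from habs u hu]
      ext i
      simp [M, mulVec_diagonal, mul_assoc]
  have hxl : x ∈ Eig l := (hmem x).2 hker
  refine ⟨?_, l, ⟨x, hx, hxl⟩, ?_, ⟨|x|, habs x hxl, hpos x hxl hx⟩, ?_⟩
  · rintro lam ⟨u, hu0, hu⟩
    have h : 0 < u ⬝ᵥ A *ᵥ u := by simpa using hA.dotProduct_mulVec_pos hu0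
    rw [hrayleigh lam u hu] at h
    exact pos_of_mul_pos_left h (hMpos u hu0).le
  · rintro lam ⟨u, hu0, hu⟩
    have h : 0 ≤ u ⬝ᵥ (A - l • M) *ᵥ u := by simpa using hpsd.dotProduct_mulVec_nonneg u
    rw [sub_mulVec, smul_mulVec, dotProduct_sub, dotProduct_smul, hrayleigh lam u hu,
      smul_eq_mul, sub_nonneg] at h
    exact le_of_mul_le_mul_right h (hMpos u hu0)
  · intro u hu v hv hu0
    let i : Fin m := ⟨0, hm⟩
    have hui : u i ≠ 0 := abs_pos.1 (hpos u hu hu0 i)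
    refine ⟨v i / u i, ?_⟩
    by_contra hne
    have hdiff : v - (v i / u i) • u ∈ Eig l := by
      rw [hmem] at hu hv ⊢
      rw [mulVec_sub, mulVec_smul, hu, hv, smul_zero, sub_zero]
    have h := hpos _ hdiff (sub_ne_zero.2 hne) i
    simp [hui] at h
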